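/- Almost surely, the generalized weighted empirical measure of the self-repellent random walk converges to the target distribution: for every initial pair (x_0, X_0) ∈ Int(Σ) × {1,…,N}, with probability one lim_{n→∞} x_n = μ. -/

import Mathlib

open MeasureTheory Filter Matrix Finset
open scoped Topology

noncomputable section

/-- The interior of the probability simplex in `ℝ^N`. -/
def intSimplex (N : ℕ) : Set (Fin N → ℝ) :=
  {x | (∀ i, 0 < x i) ∧ ∑ i, x i = 1}

/-- The self-repellent random walk (SRRW) kernel
`K_{ij}[x] = P_{ij}(x_j/μ_j)^{−α} / ∑_k P_{ik}(x_k/μ_k)^{−α}`. -/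
def srrwKernel {N : ℕ} (P : Matrix (Fin N) (Fin N) ℝ) (μ : Fin N → ℝ) (α : ℝ)
    (x : Fin N → ℝ) : Matrix (Fin N) (Fin N) ℝ :=
  Matrix.of fun i j =>
    P i j * (x j / μ j) ^ (-α) / ∑ k, P i k * (x k / μ k) ^ (-α)


lemma real_seq (v γ : ℕ → ℝ) (η d : ℝ) (hη : 0 < η) (hd : 0 < d) (hγ : ∀ n, 0 ≤ γ n)
    (hsum : Tendsto (fun n => ∑ k ∈ range n, γ k) atTop atTop) (n0 : ℕ)
    (h1 : ∀ n ≥ n0, 2 * η ≤ v n → v (n+1) ≤ v n - γ n * d)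
    (h2 : ∀ n ≥ n0, v n < 2 * η → v (n+1) < 4 * η) : ∀ᶠ n in atTop, v n < 4 * η := by
  have hex : ∃ n ≥ n0, v n < 2 * η := by
    by_contra hcon
    push Not at hcon
    have key : ∀ m, v (n0 + m) + d * ∑ k ∈ range (n0 + m), γ k
        ≤ v n0 + d * ∑ k ∈ range n0, γ k := by
      intro m
      induction m with
      | zero => simp
      | succ m ih =>
        have := h1 (n0 + m) (by omega) (hcon _ (by omega))
        rw [← add_assoc, Finset.sum_range_succ]
        nlinarith
    have ht := (hsum.const_mul_atTop hd).comp (tendsto_add_atTop_nat n0)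
    obtain ⟨m, hm⟩ := (ht.eventually_gt_atTop (v n0 + d * ∑ k ∈ range n0, γ k)).exists
    have h3 := key m
    have h4 := hcon (n0 + m) (by omega)
    simp only [Function.comp] at hm
    rw [add_comm m n0] at hm
    linarith
  obtain ⟨n1, hn1, hv⟩ := hex
  filter_upwards [eventually_ge_atTop n1] with n hn
  induction n, hn using Nat.le_induction with
  | base => linarith
  | succ n hn ih =>
    by_cases h : v n < 2 * η
    · exact h2 n (by omega) h
    · have := h1 n (by omega) (not_lt.1 h)
      nlinarith [mul_nonneg (hγ n) hd.le]

lemma det_conv {E : Type*} [NormedAddCommGroup E] [NormedSpace ℝ E] (C U : Set E)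
    (hC : IsCompact C) (hU : IsOpen U) (hCU : C ⊆ U) (V : E → ℝ) (V' : E → E →L[ℝ] ℝ)
    (hV : ∀ x ∈ U, HasFDerivAt V (V' x) x) (hV' : ContinuousOn V' U) (μ : E)
    (hμ : V μ ≤ 0) (hpos : ∀ x ∈ C, x ≠ μ → 0 < V x)
    (g : E → E) (hg : ContinuousOn g C) (hD : ∀ x ∈ C, x ≠ μ → V' x (g x) < 0)
    (x s : ℕ → E) (sI : E) (γ : ℕ → ℝ) (hxC : ∀ n, x n ∈ C)
    (hrec : ∀ n, x (n+1) = x n + γ n • g (x n) + (s (n+1) - s n))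
    (hs : Tendsto s atTop (𝓝 sI)) (hγ : ∀ n, 0 ≤ γ n) (hγ0 : Tendsto γ atTop (𝓝 0))
    (hsum : Tendsto (fun n => ∑ k ∈ range n, γ k) atTop atTop) :
    Tendsto x atTop (𝓝 μ) := by
  have hVc : ContinuousOn V U := fun y hy => (hV y hy).continuousAt.continuousWithinAt
  obtain ⟨B0, hB0⟩ := hC.exists_bound_of_continuousOn hg
  set B := max B0 1 with hBdef
  have hBpos : 0 < B := lt_of_lt_of_le one_pos (le_max_right _ _)
  have hB : ∀ y ∈ C, ‖g y‖ ≤ B := fun y hy => (hB0 y hy).trans (le_max_left _ _)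
  set z : ℕ → E := fun n => x n - s n + sI with hz
  have hzz : ∀ n, z (n+1) - z n = γ n • g (x n) := by
    intro n; simp only [hz, hrec n]; abel
  have hzx : Tendsto (fun n => z n - x n) atTop (𝓝 0) := by
    have : Tendsto (fun n => sI - s n) atTop (𝓝 (sI - sI)) := tendsto_const_nhds.sub hs
    rw [sub_self] at this
    refine this.congr fun n => ?_
    simp only [hz]; abel
  have hstep : Tendsto (fun n => γ n • g (x n)) atTop (𝓝 0) := by
    refine squeeze_zero_norm (a := fun n => γ n * B) (fun n => ?_) (by simpa using hγ0.mul_const B)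
    rw [norm_smul, Real.norm_of_nonneg (hγ n)]
    exact mul_le_mul_of_nonneg_left (hB _ (hxC n)) (hγ n)
  have hzx' : Tendsto (fun n => z (n+1) - x n) atTop (𝓝 0) := by
    have := hzx.add hstep
    rw [add_zero] at this
    refine this.congr fun n => ?_
    rw [← hzz n]; abel
  have main : ∀ η > 0, ∀ᶠ n in atTop, V (x n) < 5 * η := by
    intro η hη
    set S := C ∩ V ⁻¹' (Set.Ici η) with hS
    have hScl : IsCompact S := by
      have h1 : IsClosed S := (hVc.mono hCU).preimage_isClosed_of_isClosed hC.isClosed isClosed_Ici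
      exact hC.of_isClosed_subset h1 Set.inter_subset_left
    rcases S.eq_empty_or_nonempty with hSe | hSne
    · refine Eventually.of_forall fun n => ?_
      by_contra h
      have : x n ∈ S := ⟨hxC n, by simp only [Set.mem_preimage, Set.mem_Ici]; linarith⟩
      simp [hSe] at this
    · have hfc : ContinuousOn (fun y => V' y (g y)) S :=
        ((hV'.mono (Set.inter_subset_left.trans hCU))).clm_apply (hg.mono Set.inter_subset_left)
      obtain ⟨y0, hy0, hmax⟩ := hScl.exists_isMaxOn hSne hfc
      have hy0μ : y0 ≠ μ := by
        rintro rfl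
        have := hy0.2
        simp only [Set.mem_preimage, Set.mem_Ici] at this
        linarith
      set d := -(V' y0 (g y0)) with hd
      have hdpos : 0 < d := by have := hD y0 hy0.1 hy0μ; linarith
      have hdS : ∀ y ∈ S, V' y (g y) ≤ -d := by
        intro y hy; have := hmax hy; simp only [Set.mem_ofPred_eq] at this; linarith
      have hε : 0 < d / (2 * B) := by positivity
      have huc1 := hC.uniformContinuousAt_of_continuousAt V' 
        (fun y hy => hV'.continuousAt (hU.mem_nhds (hCU hy))) (Metric.dist_mem_uniformity hε)
      have huc2 := hC.uniformContinuousAt_of_continuousAt V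
        (fun y hy => hVc.continuousAt (hU.mem_nhds (hCU hy))) (Metric.dist_mem_uniformity hη)
      obtain ⟨δ1, hδ1, h1⟩ := Metric.mem_uniformity_dist.1 huc1
      obtain ⟨δ2, hδ2, h2⟩ := Metric.mem_uniformity_dist.1 huc2
      obtain ⟨δ3, hδ3, h3⟩ := hC.exists_thickening_subset_open hU hCU
      set δ := min δ1 (min δ2 δ3) with hδ
      have hδpos : 0 < δ := by positivity
      have hev1 : ∀ᶠ n in atTop, ‖z n - x n‖ < δ := by
        have := hzx.norm; rw [norm_zero] at this
        exact this.eventually_lt_const hδpos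
      have hev2 : ∀ᶠ n in atTop, ‖z (n+1) - x n‖ < δ := by
        have := hzx'.norm; rw [norm_zero] at this
        exact this.eventually_lt_const hδpos
      obtain ⟨n0, hn0⟩ := eventually_atTop.1 (hev1.and hev2)
      have hVclose : ∀ n, ∀ y, ‖y - x n‖ < δ → |V (x n) - V y| < η := by
        intro n y hy
        have hd : dist (x n) y < δ2 := by
          rw [dist_comm, dist_eq_norm]
          exact hy.trans_le ((min_le_right _ _).trans (min_le_left _ _))
        have := h2 hd (hxC n)
        simpa [Real.dist_eq] using this
      have hVd : ∀ n ≥ n0, V (z (n+1)) ≤ V (z n) + γ n * (V' (x n) (g (x n)) + d / 2) := by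
        intro n hn
        have hball : ∀ y ∈ Metric.ball (x n) δ, HasFDerivWithinAt V (V' y) (Metric.ball (x n) δ) y := by
          intro y hy
          refine (hV y (h3 ?_)).hasFDerivWithinAt
          rw [Metric.mem_thickening_iff]
          exact ⟨x n, hxC n, (Metric.mem_ball.1 hy).trans_le ((min_le_right _ _).trans (min_le_right _ _))⟩
        have hbd : ∀ y ∈ Metric.ball (x n) δ, ‖V' y - V' (x n)‖ ≤ d / (2 * B) := by
          intro y hy
          have hd : dist (x n) y < δ1 := by
            rw [dist_comm]; exact (Metric.mem_ball.1 hy).trans_le (min_le_left _ _)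
          have := h1 hd (hxC n)
          rw [← dist_eq_norm, dist_comm]
          exact le_of_lt (by simpa using this)
        have := (convex_ball (x n) δ).norm_image_sub_le_of_norm_hasFDerivWithin_le' hball hbd
          (x := z n) (y := z (n+1)) (by simpa [dist_eq_norm] using (hn0 n hn).1)
          (by simpa [dist_eq_norm] using (hn0 n hn).2)
        rw [hzz n, map_smul, smul_eq_mul, norm_smul, Real.norm_of_nonneg (hγ n)] at this
        have h5 := (abs_le.1 this).2
        have h6 : d / (2 * B) * (γ n * ‖g (x n)‖) ≤ γ n * (d / 2) := by
          have : d / (2 * B) * (γ n * ‖g (x n)‖) ≤ d / (2 * B) * (γ n * B) := by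
            have := hB _ (hxC n)
            have := hγ n
            gcongr
          refine this.trans (le_of_eq ?_)
          field_simp
        linarith
      have := real_seq (fun n => V (z n)) γ η (d / 2) hη (by positivity) hγ hsum n0
        (by
          intro n hn hle
          have hc := abs_lt.1 (hVclose n _ (hn0 n hn).1)
          have := hdS (x n) ⟨hxC n, by simp only [Set.mem_preimage, Set.mem_Ici]; linarith [hc.1]⟩
          have h7 := hVd n hn
          have := mul_le_mul_of_nonneg_left this (hγ n)
          linarith)
        (by
          intro n hn hle
          have hc := abs_lt.1 (hVclose n _ (hn0 n hn).1)
          have hc' := abs_lt.1 (hVclose n _ (hn0 n hn).2)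
          linarith [hc.2, hc'.1])
      filter_upwards [this, eventually_ge_atTop n0] with n hn hnn
      have hc := abs_lt.1 (hVclose n _ (hn0 n hnn).1)
      linarith [hc.2]
  rw [tendsto_nhds]
  intro O hO hμO
  rcases (C \ O).eq_empty_or_nonempty with he | hne
  · refine Eventually.of_forall fun n => ?_
    by_contra h
    have : x n ∈ C \ O := ⟨hxC n, h⟩
    simp [he] at this
  · obtain ⟨y0, hy0, hmin⟩ := (hC.diff hO).exists_isMinOn hne (hVc.mono (Set.sdiff_subset.trans hCU))
    have hp : 0 < V y0 := hpos y0 hy0.1 (by rintro rfl; exact hy0.2 hμO)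
    filter_upwards [main (V y0 / 5) (by positivity)] with n hn
    by_contra h
    have h8 := hmin (show x n ∈ C \ O from ⟨hxC n, h⟩)
    simp only [Set.mem_ofPred_eq] at h8
    linarith

lemma mart_conv {Ω : Type*} [mΩ : MeasurableSpace Ω] (Pr : Measure Ω) [IsProbabilityMeasure Pr]
    (F : Filtration ℕ mΩ) (d : ℕ → Ω → ℝ) (c : ℕ → ℝ)
    (hm : ∀ n, StronglyMeasurable[F (n+1)] (d n)) (hb : ∀ n ω, |d n ω| ≤ c n)
    (hc : Summable (fun n => c n ^ 2)) (h0 : ∀ n, Pr[d n | F n] =ᵐ[Pr] 0) :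
    ∀ᵐ ω ∂Pr, ∃ s, Tendsto (fun n => ∑ k ∈ range n, d k ω) atTop (𝓝 s) := by
  set M : ℕ → Ω → ℝ := fun n => ∑ k ∈ range n, d k with hM
  have hMad : ∀ n, StronglyMeasurable[F n] (M n) := by
    intro n
    apply Finset.stronglyMeasurable_sum
    intro k hk
    exact (hm k).mono (F.mono (by simpa using hk))
  have hMb : ∀ n ω, |M n ω| ≤ ∑ k ∈ range n, c k := by
    intro n ω
    simp only [hM, Finset.sum_apply]
    exact (Finset.abs_sum_le_sum_abs _ _).trans (Finset.sum_le_sum fun k _ => hb k ω)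
  have hint : ∀ (f : Ω → ℝ) (b : ℝ) (n : ℕ), StronglyMeasurable[F n] f → (∀ ω, |f ω| ≤ b) →
      Integrable f Pr := by
    intro f b n hf hfb
    exact Integrable.of_bound ((hf.mono (F.le n)).aestronglyMeasurable) b
      (Eventually.of_forall fun ω => by simpa using hfb ω)
  have hMi : ∀ n, Integrable (M n) Pr := fun n => hint _ _ n (hMad n) (hMb n)
  have hdi : ∀ n, Integrable (d n) Pr := fun n => hint _ _ _ (hm n) (hb n)
  have hMs : ∀ n, M (n+1) = M n + d n := fun n => by simp only [hM, Finset.sum_range_succ]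
  have hmart : Martingale M F Pr := by
    apply martingale_of_condExp_sub_eq_zero_nat hMad hMi
    intro n
    rw [hMs, add_sub_cancel_left]
    exact h0 n
  have hMd : ∀ n, Integrable (M n * d n) Pr := fun n => 
    hint _ ((∑ k ∈ range n, c k) * c n) (n+1) (((hMad n).mono (F.mono (Nat.le_succ n))).mul (hm n))
      (fun ω => by
        rw [Pi.mul_apply, abs_mul]
        exact mul_le_mul (hMb n ω) (hb n ω) (abs_nonneg _) ((abs_nonneg _).trans (hMb n ω)))
  have hMM : ∀ n, Integrable (fun ω => M n ω ^ 2) Pr := fun n =>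
    hint _ ((∑ k ∈ range n, c k)^2) n ((hMad n).pow 2)
      (fun ω => by
        rw [abs_pow]
        exact pow_le_pow_left₀ (abs_nonneg _) (hMb n ω) 2)
  have hdd : ∀ n, Integrable (fun ω => d n ω ^ 2) Pr := fun n =>
    hint _ ((c n)^2) (n+1) ((hm n).pow 2)
      (fun ω => by
        rw [abs_pow]
        exact pow_le_pow_left₀ (abs_nonneg _) (hb n ω) 2)
  have horth : ∀ n, ∫ ω, (M n * d n) ω ∂Pr = 0 := by
    intro n
    have h1 := condExp_mul_of_stronglyMeasurable_left (hMad n) (hMd n) (hdi n)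
    rw [← integral_condExp (F.le n)]
    have : Pr[M n * d n | F n] =ᵐ[Pr] 0 := by
      filter_upwards [h1, h0 n] with ω h2 h3
      rw [h2, Pi.mul_apply, h3]; simp
    rw [integral_congr_ae this]; simp
  have hL2 : ∀ n, ∫ ω, M n ω ^ 2 ∂Pr ≤ ∑ k ∈ range n, c k ^ 2 := by
    intro n
    induction n with
    | zero => simp [hM]
    | succ n ih =>
      have : (fun ω => M (n+1) ω ^ 2) = fun ω => M n ω ^ 2 + (2 * (M n * d n) ω + d n ω ^ 2) := by
        funext ω; rw [hMs]; simp only [Pi.add_apply, Pi.mul_apply]; ring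
      have e2 : ∫ ω, (2 * (M n * d n) ω + d n ω ^ 2) ∂Pr = ∫ ω, d n ω ^ 2 ∂Pr := by
        rw [integral_add ((hMd n).const_mul 2) (hdd n), integral_const_mul, horth]; simp
      have e3 : Integrable (fun ω => 2 * (M n * d n) ω + d n ω ^ 2) Pr :=
        ((hMd n).const_mul 2).add (hdd n)
      rw [this, integral_add (hMM n) e3, e2, Finset.sum_range_succ]
      have : ∫ ω, d n ω ^ 2 ∂Pr ≤ c n ^ 2 := by
        have := integral_mono (μ := Pr) (hdd n) (integrable_const (c n ^ 2)) (fun ω => by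
          rw [← sq_abs]
          exact pow_le_pow_left₀ (abs_nonneg _) (hb n ω) 2)
        simpa using this
      linarith
  have hconv := hmart.submartingale.exists_ae_tendsto_of_bdd
    (R := (1 + ∑' k, c k ^ 2).toNNReal) (by
      intro n
      rw [eLpNorm_one_eq_lintegral_enorm, ← ofReal_integral_norm_eq_lintegral_enorm (hMi n)]
      apply ENNReal.ofReal_le_ofReal
      have h1 : ∫ ω, ‖M n ω‖ ∂Pr ≤ ∫ ω, (1 + M n ω ^ 2) ∂Pr := by
        apply integral_mono (hMi n).norm ((integrable_const 1).add (hMM n))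
        intro ω
        simp only [Real.norm_eq_abs, Pi.add_apply]
        rw [← sq_abs (M n ω)]
        nlinarith [sq_nonneg (|M n ω| - 1), abs_nonneg (M n ω)]
      rw [integral_add (integrable_const 1) (hMM n)] at h1
      have h2 := hL2 n
      have h3 := hc.sum_le_tsum (range n) (fun k _ => sq_nonneg (c k))
      simp only [integral_const, probReal_univ, smul_eq_mul, mul_one] at h1
      linarith)
  filter_upwards [hconv] with ω hω
  simpa [hM] using hω

/-- one-step martingale difference vanishing -/
lemma condExp_diff {N : ℕ} {Ω : Type*} (m : MeasurableSpace Ω) [mΩ : MeasurableSpace Ω]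
    (Pr : Measure Ω) [IsProbabilityMeasure Pr] (hm : m ≤ mΩ) (Y : Ω → Fin N)
    (hY : Measurable Y) (k : Fin N → Ω → ℝ)
    (hk : ∀ j, (Pr[(fun ω => if Y ω = j then (1 : ℝ) else 0)|m]) =ᵐ[Pr] k j)
    (f : Fin N → Ω → ℝ) (hf : ∀ j, StronglyMeasurable[m] (f j)) (B : ℝ)
    (hB : ∀ j ω, |f j ω| ≤ B) (hkm : ∀ j, StronglyMeasurable[m] (k j))
    (hkb : ∀ j ω, |k j ω| ≤ 1) :
    Pr[(fun ω => f (Y ω) ω - ∑ l, k l ω * f l ω) | m] =ᵐ[Pr] 0 := by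
  set I : Fin N → Ω → ℝ := fun j ω => if Y ω = j then (1 : ℝ) else 0 with hI
  have hIm : ∀ j, StronglyMeasurable (I j) := fun j => by
    apply Measurable.stronglyMeasurable
    exact Measurable.ite (hY (measurableSet_singleton j)) measurable_const measurable_const
  have hIb : ∀ j ω, |I j ω| ≤ 1 := fun j ω => by simp only [hI]; split_ifs <;> simp
  have hIi : ∀ j, Integrable (I j) Pr := fun j =>
    Integrable.of_bound (hIm j).aestronglyMeasurable 1 (Eventually.of_forall fun ω => hIb j ω)
  have hfI : ∀ j, Integrable (f j * I j) Pr := fun j =>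
    Integrable.of_bound (((hf j).mono hm).mul (hIm j)).aestronglyMeasurable B
      (Eventually.of_forall fun ω => by
        rw [Pi.mul_apply, Real.norm_eq_abs, abs_mul]
        have := mul_le_mul (hB j ω) (hIb j ω) (abs_nonneg _) ((abs_nonneg _).trans (hB j ω))
        linarith)
  have hfk : ∀ j, Integrable (k j * f j) Pr := fun j =>
    Integrable.of_bound (((hkm j).mono hm).mul ((hf j).mono hm)).aestronglyMeasurable B
      (Eventually.of_forall fun ω => by
        rw [Pi.mul_apply, Real.norm_eq_abs, abs_mul]
        have := mul_le_mul (hkb j ω) (hB j ω) (abs_nonneg _) zero_le_one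
        linarith)
  have e1 : (fun ω => f (Y ω) ω - ∑ l, k l ω * f l ω) = (∑ l, f l * I l) - ∑ l, k l * f l := by
    funext ω
    simp [hI]
  rw [e1]
  have h1 := condExp_sub (integrable_finsetSum' univ fun j _ => hfI j)
    (integrable_finsetSum' univ fun j _ => hfk j) m (μ := Pr)
  have h2 := condExp_finsetSum (μ := Pr) (s := univ) (fun j _ => hfI j) m
  have h3 : Pr[∑ l, k l * f l | m] = ∑ l, k l * f l := condExp_of_stronglyMeasurable hm
    (Finset.stronglyMeasurable_sum _ fun j _ => (hkm j).mul (hf j))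
    (integrable_finsetSum' univ fun j _ => hfk j)
  have h4 : ∀ᵐ ω ∂Pr, ∀ j, (Pr[f j * I j | m]) ω = f j ω * (Pr[I j | m]) ω := by
    rw [ae_all_iff]; intro j
    exact condExp_mul_of_stronglyMeasurable_left (hf j) (hfI j) (hIi j)
  have h5 : ∀ᵐ ω ∂Pr, ∀ j, (Pr[I j | m]) ω = k j ω := by
    rw [ae_all_iff]; intro j; exact hk j
  filter_upwards [h1, h2, h4, h5] with ω g1 g2 g4 g5
  rw [g1, Pi.sub_apply, g2, h3]
  simp only [Finset.sum_apply, g4, g5, Pi.mul_apply, Pi.zero_apply]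
  rw [sub_eq_zero]
  exact Finset.sum_congr rfl fun j _ => mul_comm _ _

lemma abel_conv (h γ : ℕ → ℝ) (B : ℝ) (hh : ∀ n, |h n| ≤ B) (hanti : Antitone γ)
    (hγ0 : Tendsto γ atTop (𝓝 0)) :
    ∃ s, Tendsto (fun n => ∑ k ∈ range n, γ k * (h k - h (k+1))) atTop (𝓝 s) := by
  have hB : 0 ≤ B := (abs_nonneg _).trans (hh 0)
  have hpos : ∀ n, 0 ≤ γ n := fun n => hanti.le_of_tendsto hγ0 n
  have hsm : Summable (fun n => (γ (n+1) - γ n) * h (n+1)) := by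
    have hs1 : Summable (fun n => γ n - γ (n+1)) := by
      apply summable_of_sum_range_le (c := γ 0) (fun n => sub_nonneg.2 (hanti (Nat.le_succ n)))
      intro n
      rw [Finset.sum_range_sub' γ n]
      linarith [hpos n]
    refine Summable.of_norm_bounded (hs1.mul_right B) fun n => ?_
    rw [norm_mul, Real.norm_eq_abs, Real.norm_eq_abs, abs_sub_comm, 
      abs_of_nonneg (sub_nonneg.2 (hanti (Nat.le_succ n)))]
    exact mul_le_mul_of_nonneg_left (hh _) (sub_nonneg.2 (hanti (Nat.le_succ n)))
  have h0 : Tendsto (fun n => γ n * h n) atTop (𝓝 0) := by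
    refine squeeze_zero_norm (a := fun n => γ n * B) (fun n => ?_) (by simpa using hγ0.mul_const B)
    rw [norm_mul, Real.norm_of_nonneg (hpos n)]
    exact mul_le_mul_of_nonneg_left (hh n) (hpos n)
  refine ⟨γ 0 * h 0 - 0 + ∑' n, (γ (n+1) - γ n) * h (n+1), ?_⟩
  have := (tendsto_const_nhds (x := γ 0 * h 0)).sub h0 |>.add hsm.hasSum.tendsto_sum_nat
  refine this.congr fun n => ?_
  rw [← Finset.sum_range_sub' (fun n => γ n * h n) n, ← Finset.sum_add_distrib]
  exact Finset.sum_congr rfl fun k _ => by ring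
/-- positive orthant -/
def posO (N : ℕ) : Set (Fin N → ℝ) := {x | ∀ i, 0 < x i}

def srR {N : ℕ} (μ : Fin N → ℝ) (α : ℝ) (x : Fin N → ℝ) (i : Fin N) : ℝ := (x i / μ i) ^ (-α)

def srS {N : ℕ} (P : Matrix (Fin N) (Fin N) ℝ) (μ : Fin N → ℝ) (α : ℝ) (x : Fin N → ℝ)
    (i : Fin N) : ℝ := ∑ k, P i k * srR μ α x k

def srW {N : ℕ} (P : Matrix (Fin N) (Fin N) ℝ) (μ : Fin N → ℝ) (α : ℝ) (x : Fin N → ℝ) : ℝ :=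
  ∑ i, μ i * srR μ α x i * srS P μ α x i

def srPi {N : ℕ} (P : Matrix (Fin N) (Fin N) ℝ) (μ : Fin N → ℝ) (α : ℝ) (x : Fin N → ℝ)
    (i : Fin N) : ℝ := μ i * srR μ α x i * srS P μ α x i / srW P μ α x

def srA {N : ℕ} (P : Matrix (Fin N) (Fin N) ℝ) (μ : Fin N → ℝ) (α : ℝ) (x : Fin N → ℝ) :
    Matrix (Fin N) (Fin N) ℝ := 1 - srrwKernel P μ α x + Matrix.of fun _ _ => 1

def srZ {N : ℕ} (P : Matrix (Fin N) (Fin N) ℝ) (μ : Fin N → ℝ) (α : ℝ) (x : Fin N → ℝ) :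
    Matrix (Fin N) (Fin N) ℝ := (srA P μ α x)⁻¹

lemma isOpen_posO (N : ℕ) : IsOpen (posO N) := by
  have : posO N = ⋂ i, {x | 0 < x i} := by ext x; simp [posO]
  rw [this]
  exact isOpen_iInter_of_finite fun i => isOpen_lt continuous_const (continuous_apply i)

section kernel
variable {N : ℕ} {P : Matrix (Fin N) (Fin N) ℝ} {μ : Fin N → ℝ} {α : ℝ} {x : Fin N → ℝ}

lemma srR_pos (hμ : ∀ i, 0 < μ i) (hx : x ∈ posO N) (i : Fin N) : 0 < srR μ α x i :=
  Real.rpow_pos_of_pos (div_pos (hx i) (hμ i)) _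

lemma srS_pos (hP : ∀ i j, 0 ≤ P i j) (hrow : ∀ i, ∑ j, P i j = 1)
    (hμ : ∀ i, 0 < μ i) (hx : x ∈ posO N) (i : Fin N) : 0 < srS P μ α x i := by
  apply Finset.sum_pos'
  · exact fun k _ => mul_nonneg (hP i k) (srR_pos hμ hx k).le
  · by_contra h
    push Not at h
    have : ∑ j, P i j ≤ 0 := by
      apply Finset.sum_nonpos
      intro j hj
      by_contra h2
      have := mul_pos (not_le.1 h2) (srR_pos (α := α) hμ hx j)
      linarith [h j hj]
    linarith [hrow i]

lemma srW_pos (hN : 2 ≤ N) (hP : ∀ i j, 0 ≤ P i j) (hrow : ∀ i, ∑ j, P i j = 1)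
    (hμ : ∀ i, 0 < μ i) (hx : x ∈ posO N) : 0 < srW P μ α x := by
  have : Nonempty (Fin N) := ⟨⟨0, by omega⟩⟩
  apply Finset.sum_pos _ univ_nonempty
  intro i _
  exact mul_pos (mul_pos (hμ i) (srR_pos hμ hx i)) (srS_pos hP hrow hμ hx i)

lemma srPi_pos (hN : 2 ≤ N) (hP : ∀ i j, 0 ≤ P i j) (hrow : ∀ i, ∑ j, P i j = 1)
    (hμ : ∀ i, 0 < μ i) (hx : x ∈ posO N) (i : Fin N) : 0 < srPi P μ α x i :=
  div_pos (mul_pos (mul_pos (hμ i) (srR_pos hμ hx i)) (srS_pos hP hrow hμ hx i))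
    (srW_pos hN hP hrow hμ hx)

lemma srPi_sum (hN : 2 ≤ N) (hP : ∀ i j, 0 ≤ P i j) (hrow : ∀ i, ∑ j, P i j = 1)
    (hμ : ∀ i, 0 < μ i) (hx : x ∈ posO N) : ∑ i, srPi P μ α x i = 1 := by
  simp only [srPi]
  rw [← Finset.sum_div]
  exact div_self (srW_pos hN hP hrow hμ hx).ne'

lemma srK_eq (i j : Fin N) : srrwKernel P μ α x i j = P i j * srR μ α x j / srS P μ α x i := rfl

lemma srK_nonneg (hP : ∀ i j, 0 ≤ P i j) (hrow : ∀ i, ∑ j, P i j = 1)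
    (hμ : ∀ i, 0 < μ i) (hx : x ∈ posO N) (i j : Fin N) : 0 ≤ srrwKernel P μ α x i j := by
  rw [srK_eq]
  exact div_nonneg (mul_nonneg (hP i j) (srR_pos hμ hx j).le) (srS_pos hP hrow hμ hx i).le

lemma srK_sum (hP : ∀ i j, 0 ≤ P i j) (hrow : ∀ i, ∑ j, P i j = 1)
    (hμ : ∀ i, 0 < μ i) (hx : x ∈ posO N) (i : Fin N) : ∑ j, srrwKernel P μ α x i j = 1 := by
  simp only [srK_eq]
  rw [← Finset.sum_div]
  exact div_self (srS_pos hP hrow hμ hx i).ne'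

lemma srK_le (hP : ∀ i j, 0 ≤ P i j) (hrow : ∀ i, ∑ j, P i j = 1)
    (hμ : ∀ i, 0 < μ i) (hx : x ∈ posO N) (i j : Fin N) : srrwKernel P μ α x i j ≤ 1 := by
  rw [← srK_sum (α := α) hP hrow hμ hx i]
  exact Finset.single_le_sum (f := fun j => srrwKernel P μ α x i j)
    (fun k _ => srK_nonneg hP hrow hμ hx i k) (mem_univ j)

lemma srPi_rev_eq (hP : ∀ i j, 0 ≤ P i j) (hrow : ∀ i, ∑ j, P i j = 1)
    (hμ : ∀ i, 0 < μ i) (hx : x ∈ posO N) (i j : Fin N) :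
    srPi P μ α x i * srrwKernel P μ α x i j
      = μ i * P i j * srR μ α x i * srR μ α x j / srW P μ α x := by
  rw [srK_eq, srPi]
  have := (srS_pos (α := α) hP hrow hμ hx i).ne'
  field_simp

lemma srPi_rev (hP : ∀ i j, 0 ≤ P i j) (hrow : ∀ i, ∑ j, P i j = 1)
    (hμ : ∀ i, 0 < μ i) (hrev : ∀ i j, μ i * P i j = μ j * P j i) (hx : x ∈ posO N)
    (i j : Fin N) :
    srPi P μ α x i * srrwKernel P μ α x i j = srPi P μ α x j * srrwKernel P μ α x j i := by
  rw [srPi_rev_eq hP hrow hμ hx, srPi_rev_eq hP hrow hμ hx, hrev i j]; ring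

lemma srPi_stat (hP : ∀ i j, 0 ≤ P i j) (hrow : ∀ i, ∑ j, P i j = 1)
    (hμ : ∀ i, 0 < μ i) (hrev : ∀ i j, μ i * P i j = μ j * P j i) (hx : x ∈ posO N)
    (j : Fin N) :
    ∑ i, srPi P μ α x i * srrwKernel P μ α x i j = srPi P μ α x j := by
  simp_rw [srPi_rev hP hrow hμ hrev hx _ j]
  rw [← Finset.mul_sum, srK_sum hP hrow hμ hx, mul_one]

lemma const_of_edges (hP : ∀ i j, 0 ≤ P i j) (v : Fin N → ℝ)
    (hv : ∀ i j, 0 < P i j → v i = v j) (k : ℕ) :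
    ∀ i j, 0 < (P ^ k) i j → v i = v j := by
  have hnn : ∀ k : ℕ, ∀ i j, 0 ≤ (P ^ k) i j := by
    intro k
    induction k with
    | zero => intro i j; rw [pow_zero, Matrix.one_apply]; split_ifs <;> simp
    | succ k ih =>
      intro i j
      rw [pow_succ, Matrix.mul_apply]
      exact Finset.sum_nonneg fun l _ => mul_nonneg (ih i l) (hP l j)
  induction k with
  | zero =>
    intro i j h
    rw [pow_zero, Matrix.one_apply] at h
    split_ifs at h with h1
    · rw [h1]
    · simp at h
  | succ k ih =>
    intro i j h
    rw [pow_succ, Matrix.mul_apply] at h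
    obtain ⟨l, -, hl⟩ := Finset.exists_ne_zero_of_sum_ne_zero h.ne'
    have h1 : (P ^ k) i l ≠ 0 := left_ne_zero_of_mul hl
    have h2 : P l j ≠ 0 := right_ne_zero_of_mul hl
    exact (ih i l (lt_of_le_of_ne (hnn k i l) h1.symm)).trans
      (hv l j (lt_of_le_of_ne (hP l j) h2.symm))

lemma srA_mulVec (v : Fin N → ℝ) (i : Fin N) :
    (srA P μ α x *ᵥ v) i = v i - ∑ j, srrwKernel P μ α x i j * v j + ∑ j, v j := by
  rw [srA, Matrix.add_mulVec, Matrix.sub_mulVec, Matrix.one_mulVec]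
  simp [Matrix.mulVec, dotProduct]

lemma srPi_A (hN : 2 ≤ N) (hP : ∀ i j, 0 ≤ P i j) (hrow : ∀ i, ∑ j, P i j = 1)
    (hμ : ∀ i, 0 < μ i) (hrev : ∀ i j, μ i * P i j = μ j * P j i) (hx : x ∈ posO N)
    (v : Fin N → ℝ) :
    ∑ i, srPi P μ α x i * (srA P μ α x *ᵥ v) i = ∑ j, v j := by
  simp_rw [srA_mulVec, mul_add, mul_sub, Finset.sum_add_distrib, Finset.sum_sub_distrib]
  rw [← Finset.sum_mul, srPi_sum hN hP hrow hμ hx, one_mul]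
  simp_rw [Finset.mul_sum]
  rw [Finset.sum_comm]
  simp_rw [← mul_assoc, ← Finset.sum_mul, srPi_stat hP hrow hμ hrev hx]
  simp

lemma srA_det (hN : 2 ≤ N) (hP : ∀ i j, 0 ≤ P i j) (hrow : ∀ i, ∑ j, P i j = 1)
    (hprim : ∃ k : ℕ, ∀ i j, 0 < (P ^ k) i j)
    (hμ : ∀ i, 0 < μ i) (hrev : ∀ i j, μ i * P i j = μ j * P j i) (hx : x ∈ posO N) :
    (srA P μ α x).det ≠ 0 := by
  intro hdet
  obtain ⟨v, hv0, hv⟩ := Matrix.exists_mulVec_eq_zero_iff.2 hdet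
  have hsum : ∑ j, v j = 0 := by
    rw [← srPi_A hN hP hrow hμ hrev hx v (α := α), hv]; simp
  have hKv : ∀ i, ∑ j, srrwKernel P μ α x i j * v j = v i := by
    intro i
    have := congrFun hv i
    rw [srA_mulVec, hsum] at this
    simp only [Pi.zero_apply] at this
    linarith
  have hdir : ∑ i, ∑ j, srPi P μ α x i * srrwKernel P μ α x i j * (v i - v j)^2 = 0 := by
    have e : ∀ i j, srPi P μ α x i * srrwKernel P μ α x i j * (v i - v j)^2
        = srPi P μ α x i * v i ^ 2 * srrwKernel P μ α x i j
          - 2 * (srPi P μ α x i * v i) * (srrwKernel P μ α x i j * v j)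
          + (srPi P μ α x i * srrwKernel P μ α x i j) * v j ^ 2 := fun i j => by ring
    simp_rw [e, Finset.sum_add_distrib, Finset.sum_sub_distrib, ← Finset.mul_sum,
      srK_sum hP hrow hμ hx, hKv]
    rw [Finset.sum_comm (f := fun i j => (srPi P μ α x i * srrwKernel P μ α x i j) * v j ^ 2)]
    simp_rw [← Finset.sum_mul, srPi_stat hP hrow hμ hrev hx]
    rw [mul_one, ← Finset.sum_sub_distrib, ← Finset.sum_add_distrib]
    exact Finset.sum_eq_zero fun i _ => by ring
  have hnn : ∀ i j, 0 ≤ srPi P μ α x i * srrwKernel P μ α x i j * (v i - v j)^2 := fun i j =>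
    mul_nonneg (mul_nonneg (srPi_pos hN hP hrow hμ hx i).le (srK_nonneg hP hrow hμ hx i j))
      (sq_nonneg _)
  have hedge : ∀ i j, 0 < P i j → v i = v j := by
    intro i j hij
    have h1 := (Finset.sum_eq_zero_iff_of_nonneg
      (fun i _ => Finset.sum_nonneg fun j _ => hnn i j)).1 hdir i (mem_univ i)
    have h2 := (Finset.sum_eq_zero_iff_of_nonneg (fun j _ => hnn i j)).1 h1 j (mem_univ j)
    have hK : 0 < srrwKernel P μ α x i j := by
      rw [srK_eq]
      exact div_pos (mul_pos hij (srR_pos hμ hx j)) (srS_pos hP hrow hμ hx i)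
    have hpi := srPi_pos (α := α) hN hP hrow hμ hx i
    have h3 : (v i - v j)^2 = 0 := by
      rcases mul_eq_zero.1 h2 with h | h
      · exact absurd h (mul_pos hpi hK).ne'
      · exact h
    have := pow_eq_zero_iff (two_ne_zero) |>.1 h3
    linarith
  obtain ⟨k, hk⟩ := hprim
  have hconst : ∀ i j, v i = v j := fun i j => const_of_edges hP v hedge k i j (hk i j)
  apply hv0
  funext i
  have : ∑ j, v j = N * v i := by
    rw [Finset.sum_congr rfl (fun j _ => hconst j i)]; simp
  rw [hsum] at this
  have hN0 : (N : ℝ) ≠ 0 := by positivity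
  rcases mul_eq_zero.1 this.symm with h | h
  · exact absurd h hN0
  · simpa using h

lemma srZ_poisson (hN : 2 ≤ N) (hP : ∀ i j, 0 ≤ P i j) (hrow : ∀ i, ∑ j, P i j = 1)
    (hprim : ∃ k : ℕ, ∀ i j, 0 < (P ^ k) i j)
    (hμ : ∀ i, 0 < μ i) (hrev : ∀ i j, μ i * P i j = μ j * P j i) (hx : x ∈ posO N)
    (i j : Fin N) :
    srZ P μ α x i j - ∑ l, srrwKernel P μ α x i l * srZ P μ α x l j
      = (if i = j then 1 else 0) - srPi P μ α x j := by
  have hdet := srA_det (α := α) hN hP hrow hprim hμ hrev hx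
  have hAZ : srA P μ α x * srZ P μ α x = 1 :=
    Matrix.mul_nonsing_inv _ (isUnit_iff_ne_zero.2 hdet)
  have hcol : ∀ i, (srA P μ α x *ᵥ (fun l => srZ P μ α x l j)) i = if i = j then 1 else 0 := by
    intro i
    have := congrFun (congrFun hAZ i) j
    rw [Matrix.mul_apply, Matrix.one_apply] at this
    exact this
  have h1 := srPi_A (α := α) hN hP hrow hμ hrev hx (fun l => srZ P μ α x l j)
  simp_rw [hcol] at h1
  have h2 := hcol i
  rw [srA_mulVec] at h2
  simp only [mul_ite, mul_one, mul_zero, Finset.sum_ite_eq', mem_univ, if_true] at h1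
  rw [← h2, h1]; ring

lemma srR_contDiff (hμ : ∀ i, 0 < μ i) (i : Fin N) :
    ContDiffOn ℝ 1 (fun x => srR μ α x i) (posO N) := by
  intro y hy
  apply ContDiffAt.contDiffWithinAt
  unfold srR
  apply ContDiffAt.rpow_const_of_ne
  · exact (contDiff_apply ℝ ℝ i).contDiffAt.div_const _
  · exact (div_pos (hy i) (hμ i)).ne'

lemma srS_contDiff (hμ : ∀ i, 0 < μ i) (i : Fin N) :
    ContDiffOn ℝ 1 (fun x => srS P μ α x i) (posO N) := by
  unfold srS
  exact ContDiffOn.sum fun k _ => contDiffOn_const.mul (srR_contDiff hμ k)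

lemma srW_contDiff (hμ : ∀ i, 0 < μ i) :
    ContDiffOn ℝ 1 (fun x => srW P μ α x) (posO N) := by
  unfold srW
  exact ContDiffOn.sum fun k _ =>
    (contDiffOn_const.mul (srR_contDiff hμ k)).mul (srS_contDiff hμ k)

lemma srPi_contDiff (hN : 2 ≤ N) (hP : ∀ i j, 0 ≤ P i j) (hrow : ∀ i, ∑ j, P i j = 1)
    (hμ : ∀ i, 0 < μ i) (i : Fin N) :
    ContDiffOn ℝ 1 (fun x => srPi P μ α x i) (posO N) := by
  unfold srPi
  exact ((contDiffOn_const.mul (srR_contDiff hμ i)).mul (srS_contDiff hμ i)).div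
    (srW_contDiff hμ) (fun y hy => (srW_pos hN hP hrow hμ hy).ne')

lemma srK_contDiff (hP : ∀ i j, 0 ≤ P i j) (hrow : ∀ i, ∑ j, P i j = 1)
    (hμ : ∀ i, 0 < μ i) (i j : Fin N) :
    ContDiffOn ℝ 1 (fun x => srrwKernel P μ α x i j) (posO N) := by
  simp_rw [srK_eq]
  exact (contDiffOn_const.mul (srR_contDiff hμ j)).div
    (srS_contDiff hμ i) (fun y hy => (srS_pos hP hrow hμ hy i).ne')

lemma det_contDiff {U : Set (Fin N → ℝ)} (A : (Fin N → ℝ) → Matrix (Fin N) (Fin N) ℝ)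
    (hA : ∀ i j, ContDiffOn ℝ 1 (fun x => A x i j) U) :
    ContDiffOn ℝ 1 (fun x => (A x).det) U := by
  simp_rw [Matrix.det_apply]
  refine ContDiffOn.sum fun σ _ => ?_
  exact (contDiffOn_prod fun i _ => hA (σ i) i).const_smul _

lemma inv_contDiff {U : Set (Fin N → ℝ)} (A : (Fin N → ℝ) → Matrix (Fin N) (Fin N) ℝ)
    (hA : ∀ i j, ContDiffOn ℝ 1 (fun x => A x i j) U) (hdet : ∀ x ∈ U, (A x).det ≠ 0)
    (i j : Fin N) :
    ContDiffOn ℝ 1 (fun x => (A x)⁻¹ i j) U := by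
  simp_rw [Matrix.inv_def, Matrix.smul_apply, Ring.inverse_eq_inv', smul_eq_mul,
    Matrix.adjugate_apply]
  refine ((det_contDiff A hA).inv hdet).mul (det_contDiff _ fun k l => ?_)
  simp_rw [Matrix.updateRow_apply]
  split_ifs with h
  · exact contDiffOn_const
  · exact hA k l

lemma srZ_contDiff (hN : 2 ≤ N) (hP : ∀ i j, 0 ≤ P i j) (hrow : ∀ i, ∑ j, P i j = 1)
    (hprim : ∃ k : ℕ, ∀ i j, 0 < (P ^ k) i j)
    (hμ : ∀ i, 0 < μ i) (hrev : ∀ i j, μ i * P i j = μ j * P j i) (i j : Fin N) :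
    ContDiffOn ℝ 1 (fun x => srZ P μ α x i j) (posO N) := by
  unfold srZ
  apply inv_contDiff _ _ (fun y hy => srA_det hN hP hrow hprim hμ hrev hy)
  intro k l
  simp only [srA, Matrix.add_apply, Matrix.sub_apply, Matrix.of_apply]
  exact (contDiffOn_const.sub (srK_contDiff hP hrow hμ k l)).add contDiffOn_const

/-- the conditional expectation of the Poisson solution -/
def srH (P : Matrix (Fin N) (Fin N) ℝ) (μ : Fin N → ℝ) (α : ℝ) (x : Fin N → ℝ)
    (i j : Fin N) : ℝ := ∑ l, srrwKernel P μ α x i l * srZ P μ α x l j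

lemma srH_contDiff (hN : 2 ≤ N) (hP : ∀ i j, 0 ≤ P i j) (hrow : ∀ i, ∑ j, P i j = 1)
    (hprim : ∃ k : ℕ, ∀ i j, 0 < (P ^ k) i j)
    (hμ : ∀ i, 0 < μ i) (hrev : ∀ i j, μ i * P i j = μ j * P j i) (i j : Fin N) :
    ContDiffOn ℝ 1 (fun x => srH P μ α x i j) (posO N) := by
  unfold srH
  exact ContDiffOn.sum fun l _ =>
    (srK_contDiff hP hrow hμ i l).mul (srZ_contDiff hN hP hrow hprim hμ hrev l j)

end kernel
section lyapunov
variable {N : ℕ} {P : Matrix (Fin N) (Fin N) ℝ} {μ : Fin N → ℝ} {α : ℝ} {x : Fin N → ℝ}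

lemma srR_hasFDerivAt (hμ : ∀ i, 0 < μ i) (hx : x ∈ posO N) (i : Fin N) :
    HasFDerivAt (fun y => srR μ α y i)
      ((-α * srR μ α x i / x i) • (ContinuousLinearMap.proj i : (Fin N → ℝ) →L[ℝ] ℝ)) x := by
  have h1 : HasDerivAt (fun t : ℝ => (t / μ i) ^ (-α)) (-α * srR μ α x i / x i) (x i) := by
    have hpos := div_pos (hx i) (hμ i)
    have := ((hasDerivAt_id (x i)).div_const (μ i)).rpow_const (p := -α) (Or.inl hpos.ne')
    have h3 : HasDerivAt (fun t : ℝ => (t / μ i) ^ (-α))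
        (1 / μ i * -α * (x i / μ i) ^ (-α - 1)) (x i) := this
    convert h3 using 1
    rw [Real.rpow_sub_one hpos.ne', srR]
    have := (hx i).ne'
    have := (hμ i).ne'
    field_simp
  have h2 : HasFDerivAt (fun y : Fin N → ℝ => y i)
      (ContinuousLinearMap.proj i : (Fin N → ℝ) →L[ℝ] ℝ) x := hasFDerivAt_apply i x
  exact h1.comp_hasFDerivAt x h2

lemma srW_fderiv (hμ : ∀ i, 0 < μ i) (hrev : ∀ i j, μ i * P i j = μ j * P j i)
    (hx : x ∈ posO N) (v : Fin N → ℝ) :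
    fderiv ℝ (srW P μ α) x v
      = -2 * α * ∑ i, μ i * srR μ α x i * srS P μ α x i / x i * v i := by
  have hS : ∀ i, HasFDerivAt (fun y => srS P μ α y i)
      (∑ k, P i k • ((-α * srR μ α x k / x k) •
        (ContinuousLinearMap.proj k : (Fin N → ℝ) →L[ℝ] ℝ))) x := by
    intro i
    exact HasFDerivAt.fun_sum fun k _ => (srR_hasFDerivAt hμ hx k).const_mul (P i k)
  have hW : HasFDerivAt (srW P μ α) _ x := HasFDerivAt.fun_sum fun i _ =>
    ((srR_hasFDerivAt (α := α) hμ hx i).const_mul (μ i)).mul (hS i)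
  rw [hW.fderiv]
  simp only [_root_.sum_apply, _root_.add_apply,
    _root_.smul_apply, ContinuousLinearMap.proj_apply, smul_eq_mul]
  rw [Finset.sum_add_distrib]
  have e1 : ∑ i, μ i * srR μ α x i * ∑ k, P i k * (-α * srR μ α x k / x k * v k)
      = ∑ k, srS P μ α x k * (μ k * (-α * srR μ α x k / x k * v k)) := by
    simp_rw [Finset.mul_sum, srS, Finset.sum_mul]
    rw [Finset.sum_comm]
    refine Finset.sum_congr rfl fun k _ => Finset.sum_congr rfl fun i _ => ?_
    linear_combination (srR μ α x i * (-α * srR μ α x k / x k * v k)) * hrev i k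
  rw [e1, ← two_mul, Finset.mul_sum, Finset.mul_sum]
  refine Finset.sum_congr rfl fun k _ => ?_
  ring

lemma srPi_fixed (hN : 2 ≤ N) (hP : ∀ i j, 0 ≤ P i j) (hrow : ∀ i, ∑ j, P i j = 1)
    (hμ : ∀ i, 0 < μ i) (hμs : ∑ i, μ i = 1) (hα : 0 ≤ α) (hx : x ∈ intSimplex N)
    (hfix : ∀ i, srPi P μ α x i = x i) : x = μ := by
  have hxp : x ∈ posO N := hx.1
  have : Nonempty (Fin N) := ⟨⟨0, by omega⟩⟩
  have hW := srW_pos (α := α) hN hP hrow hμ hxp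
  set y : Fin N → ℝ := fun i => x i / μ i with hy
  have hyp : ∀ i, 0 < y i := fun i => div_pos (hxp i) (hμ i)
  have heq : ∀ i, y i * srW P μ α x = srR μ α x i * srS P μ α x i := by
    intro i
    have h := hfix i
    rw [srPi, div_eq_iff hW.ne'] at h
    simp only [hy]
    rw [div_mul_eq_mul_div, ← h]
    have := (hμ i).ne'
    field_simp
  obtain ⟨i, hi⟩ := Finite.exists_max y
  obtain ⟨j, hj⟩ := Finite.exists_min y
  have hmono : ∀ k l, y k ≤ y l → srR μ α x l ≤ srR μ α x k := fun k l hkl =>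
    Real.rpow_le_rpow_of_nonpos (hyp k) hkl (by linarith)
  have hSi : srS P μ α x i ≤ srR μ α x j := by
    calc srS P μ α x i ≤ ∑ k, P i k * srR μ α x j :=
          Finset.sum_le_sum fun k _ => mul_le_mul_of_nonneg_left (hmono j k (hj k)) (hP i k)
      _ = srR μ α x j := by rw [← Finset.sum_mul, hrow, one_mul]
  have hSj : srR μ α x i ≤ srS P μ α x j := by
    calc srR μ α x i = ∑ k, P j k * srR μ α x i := by rw [← Finset.sum_mul, hrow, one_mul]
      _ ≤ srS P μ α x j :=
          Finset.sum_le_sum fun k _ => mul_le_mul_of_nonneg_left (hmono k i (hi k)) (hP j k)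
  have hij : y i ≤ y j := by
    have h1 : y i * srW P μ α x ≤ y j * srW P μ α x := by
      rw [heq i, heq j]
      calc _ ≤ srR μ α x i * srR μ α x j :=
            mul_le_mul_of_nonneg_left hSi (srR_pos hμ hxp i).le
        _ = srR μ α x j * srR μ α x i := mul_comm _ _
        _ ≤ _ := mul_le_mul_of_nonneg_left hSj (srR_pos hμ hxp j).le
    exact le_of_mul_le_mul_right h1 hW
  have hc : ∀ k, x k = y i * μ k := by
    intro k
    have h1 : y k = y i := le_antisymm (hi k) (hij.trans (hj k))
    rw [← h1]; simp only [hy]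
    rw [div_mul_cancel₀ _ (hμ k).ne']
  have h1 : y i = 1 := by
    have := hx.2
    rw [Finset.sum_congr rfl (fun k _ => hc k), ← Finset.mul_sum, hμs, mul_one] at this
    exact this
  funext k
  rw [hc k, h1, one_mul]

lemma srW_fderiv_neg (hN : 2 ≤ N) (hP : ∀ i j, 0 ≤ P i j) (hrow : ∀ i, ∑ j, P i j = 1)
    (hμ : ∀ i, 0 < μ i) (hμs : ∑ i, μ i = 1) (hrev : ∀ i j, μ i * P i j = μ j * P j i)
    (hα : 0 < α) (hx : x ∈ intSimplex N) (hne : x ≠ μ) :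
    fderiv ℝ (srW P μ α) x (fun i => srPi P μ α x i - x i) < 0 := by
  have hxp : x ∈ posO N := hx.1
  have hW := srW_pos (α := α) hN hP hrow hμ hxp
  rw [srW_fderiv hμ hrev hxp]
  have e : ∑ i, μ i * srR μ α x i * srS P μ α x i / x i * (srPi P μ α x i - x i)
      = srW P μ α x * ∑ i, (srPi P μ α x i - x i) ^ 2 / x i := by
    have e1 : ∀ i, μ i * srR μ α x i * srS P μ α x i / x i * (srPi P μ α x i - x i)
        = srW P μ α x * ((srPi P μ α x i - x i) ^ 2 / x i) 
          + srW P μ α x * (srPi P μ α x i - x i) := by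
      intro i
      have h1 : μ i * srR μ α x i * srS P μ α x i = srPi P μ α x i * srW P μ α x := by
        rw [srPi, div_mul_cancel₀ _ hW.ne']
      rw [h1]
      have := (hxp i).ne'
      field_simp
      ring
    simp_rw [e1]
    rw [Finset.sum_add_distrib, ← Finset.mul_sum, ← Finset.mul_sum, Finset.sum_sub_distrib,
      srPi_sum hN hP hrow hμ hxp, hx.2]
    ring
  rw [e]
  have hpos : 0 < ∑ i, (srPi P μ α x i - x i) ^ 2 / x i := by
    apply Finset.sum_pos'
    · exact fun i _ => div_nonneg (sq_nonneg _) (hxp i).le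
    · by_contra h
      push Not at h
      apply hne
      apply srPi_fixed hN hP hrow hμ hμs hα.le hx
      intro i
      by_contra h2
      have := div_pos (sq_pos_of_ne_zero (sub_ne_zero.2 h2)) (hxp i)
      linarith [h i (mem_univ i)]
  have := mul_pos hα (mul_pos hW hpos)
  linarith

lemma srW_gt_one (hP : ∀ i j, 0 ≤ P i j) (hrow : ∀ i, ∑ j, P i j = 1)
    (hμ : ∀ i, 0 < μ i) (hμs : ∑ i, μ i = 1) (hrev : ∀ i j, μ i * P i j = μ j * P j i)
    (hα : 0 < α) (hx : x ∈ intSimplex N) (hne : x ≠ μ) : 1 < srW P μ α x := by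
  have hxp : x ∈ posO N := hx.1
  have hr := fun i => srR_pos (α := α) hμ hxp i
  have hcol : ∀ j, ∑ i, μ i * P i j = μ j := by
    intro j
    simp_rw [hrev _ j]
    rw [← Finset.mul_sum, hrow, mul_one]
  have h1 : 1 + 2 * ∑ i, μ i * Real.log (srR μ α x i) ≤ srW P μ α x := by
    have e1 : srW P μ α x = ∑ i, ∑ j, μ i * P i j * (srR μ α x i * srR μ α x j) := by
      simp only [srW, srS, Finset.mul_sum]
      exact Finset.sum_congr rfl fun i _ => Finset.sum_congr rfl fun j _ => by ring
    have e2 : 1 + 2 * ∑ i, μ i * Real.log (srR μ α x i)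
        = ∑ i, ∑ j, μ i * P i j * (1 + Real.log (srR μ α x i) + Real.log (srR μ α x j)) := by
      simp_rw [mul_add, mul_one, Finset.sum_add_distrib]
      rw [Finset.sum_comm (f := fun i j => μ i * P i j * Real.log (srR μ α x j))]
      simp_rw [← Finset.sum_mul, hcol, ← Finset.mul_sum, hrow, mul_one, hμs]
      ring
    rw [e1, e2]
    refine Finset.sum_le_sum fun i _ => Finset.sum_le_sum fun j _ => ?_
    apply mul_le_mul_of_nonneg_left _ (mul_nonneg (hμ i).le (hP i j))
    have := Real.log_le_sub_one_of_pos (mul_pos (hr i) (hr j))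
    rw [Real.log_mul (hr i).ne' (hr j).ne'] at this
    linarith
  have h2 : 0 < ∑ i, μ i * Real.log (srR μ α x i) := by
    obtain ⟨i0, hi0⟩ := Function.ne_iff.1 hne
    have e3 : ∀ i, Real.log (srR μ α x i) = -α * Real.log (x i / μ i) := fun i =>
      Real.log_rpow (div_pos (hxp i) (hμ i)) _
    have h3 : ∑ i, μ i * Real.log (x i / μ i) < ∑ i, (x i - μ i) := by
      apply Finset.sum_lt_sum
      · intro i _
        have := Real.log_le_sub_one_of_pos (div_pos (hxp i) (hμ i))
        calc _ ≤ μ i * (x i / μ i - 1) := mul_le_mul_of_nonneg_left this (hμ i).le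
          _ = _ := by have := (hμ i).ne'; field_simp
      · refine ⟨i0, mem_univ _, ?_⟩
        have := Real.log_lt_sub_one_of_pos (div_pos (hxp i0) (hμ i0))
          (by rw [Ne, div_eq_one_iff_eq (hμ i0).ne']; exact hi0)
        calc _ < μ i0 * (x i0 / μ i0 - 1) := mul_lt_mul_of_pos_left this (hμ i0)
          _ = _ := by have := (hμ i0).ne'; field_simp
    rw [Finset.sum_sub_distrib, hx.2, hμs, sub_self] at h3
    have e4 : ∑ i, μ i * Real.log (srR μ α x i) = -α * ∑ i, μ i * Real.log (x i / μ i) := by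
      rw [Finset.mul_sum]
      exact Finset.sum_congr rfl fun i _ => by rw [e3]; ring
    rw [e4]
    nlinarith
  linarith

lemma exists_lyap (hN : 2 ≤ N) (hP : ∀ i j, 0 ≤ P i j) (hrow : ∀ i, ∑ j, P i j = 1)
    (hμ : ∀ i, 0 < μ i) (hμs : ∑ i, μ i = 1) (hrev : ∀ i j, μ i * P i j = μ j * P j i)
    (hα : 0 ≤ α) :
    ∃ V : (Fin N → ℝ) → ℝ, ContDiffOn ℝ 1 V (posO N) ∧ V μ ≤ 0 ∧
      (∀ x ∈ intSimplex N, x ≠ μ → 0 < V x) ∧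
      (∀ x ∈ intSimplex N, x ≠ μ → fderiv ℝ V x (fun i => srPi P μ α x i - x i) < 0) := by
  rcases hα.eq_or_lt with h0 | hpos
  · subst h0
    have hd : ∀ y ∈ (Set.univ : Set (Fin N → ℝ)), HasFDerivAt (fun y : Fin N → ℝ => ∑ i, (y i - μ i) ^ 2)
        (∑ i, (2 * (y i - μ i)) • (ContinuousLinearMap.proj i : (Fin N → ℝ) →L[ℝ] ℝ)) y := by
      intro y _
      refine HasFDerivAt.fun_sum fun i _ => ?_
      have h1 : HasDerivAt (fun t : ℝ => (t - μ i) ^ 2) (2 * (y i - μ i)) (y i) := by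
        simpa using ((hasDerivAt_id (y i)).sub_const (μ i)).fun_pow 2
      have h2 : HasFDerivAt (fun y : Fin N → ℝ => y i)
          (ContinuousLinearMap.proj i : (Fin N → ℝ) →L[ℝ] ℝ) y := hasFDerivAt_apply i y
      exact h1.comp_hasFDerivAt y h2
    have hp : ∀ x : Fin N → ℝ, x ≠ μ → 0 < ∑ i, (x i - μ i) ^ 2 := by
      intro x hne
      obtain ⟨i0, hi0⟩ := Function.ne_iff.1 hne
      exact Finset.sum_pos' (fun i _ => sq_nonneg _)
        ⟨i0, mem_univ _, sq_pos_of_ne_zero (sub_ne_zero.2 hi0)⟩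
    refine ⟨fun y => ∑ i, (y i - μ i) ^ 2, ?_, by simp, fun x _ hne => hp x hne, ?_⟩
    · exact ContDiffOn.sum fun i _ =>
        ((contDiff_apply ℝ ℝ i).contDiffOn.sub contDiffOn_const).pow 2
    · intro x hx hne
      have hpi : ∀ i, srPi P μ 0 x i = μ i := by
        intro i
        simp [srPi, srW, srS, srR, hrow, hμs]
      rw [(hd x trivial).fderiv]
      simp only [_root_.sum_apply, _root_.smul_apply,
        ContinuousLinearMap.proj_apply, smul_eq_mul, hpi]
      have := hp x hne
      have e : ∑ i, 2 * (x i - μ i) * (μ i - x i) = -2 * ∑ i, (x i - μ i) ^ 2 := by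
        rw [Finset.mul_sum]; exact Finset.sum_congr rfl fun i _ => by ring
      rw [e]; linarith
  · refine ⟨fun y => srW P μ α y - 1, (srW_contDiff hμ).sub contDiffOn_const, ?_, ?_, ?_⟩
    · have : ∀ i, srR μ α μ i = 1 := fun i => by simp [srR, div_self (hμ i).ne']
      simp [srW, srS, this, hrow, hμs]
    · intro x hx hne
      linarith [srW_gt_one hP hrow hμ hμs hrev hpos hx hne]
    · intro x hx hne
      rw [fderiv_sub_const]
      exact srW_fderiv_neg hN hP hrow hμ hμs hrev hpos hx hne

end lyapunov
lemma fin_bdd {N : ℕ} (p : Fin N → ℝ → Prop) (hmono : ∀ i a b, a ≤ b → p i a → p i b)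
    (h : ∀ i, ∃ B, p i B) : ∃ B, 0 ≤ B ∧ ∀ i, p i B := by
  choose b hb using h
  refine ⟨∑ i, |b i|, Finset.sum_nonneg fun i _ => abs_nonneg _, fun i => hmono i _ _ ?_ (hb i)⟩
  exact (le_abs_self _).trans
    (Finset.single_le_sum (f := fun i => |b i|) (fun i _ => abs_nonneg _) (mem_univ i))

lemma meas_select {N : ℕ} {Ω : Type*} [MeasurableSpace Ω] (Y : Ω → Fin N) (hY : Measurable Y)
    (f : Fin N → Ω → ℝ) (hf : ∀ i, Measurable (f i)) : Measurable (fun ω => f (Y ω) ω) := by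
  have : (fun ω => f (Y ω) ω) = fun ω => ∑ i, if Y ω = i then f i ω else 0 := by
    funext ω; simp
  rw [this]
  exact Finset.measurable_fun_sum _ fun i _ =>
    Measurable.ite (hY (measurableSet_singleton i)) (hf i) measurable_const

/-- compact box -/
def box (N m : ℕ) : Set (Fin N → ℝ) := Set.Icc (fun _ => 1 / ((m : ℝ) + 1)) (fun _ => 1)

lemma box_sub (N m : ℕ) : box N m ⊆ posO N := fun x hx i =>
  lt_of_lt_of_le (by positivity) (hx.1 i)

lemma box_compact (N m : ℕ) : IsCompact (box N m) := isCompact_Icc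

lemma box_convex (N m : ℕ) : Convex ℝ (box N m) := convex_Icc _ _

lemma bound_on_box {N : ℕ} (m : ℕ) (f : Fin N → (Fin N → ℝ) → ℝ)
    (hf : ∀ i, ContDiffOn ℝ 1 (f i) (posO N)) :
    ∃ B, 0 ≤ B ∧ ∀ i, ∀ y ∈ box N m, |f i y| ≤ B := by
  apply fin_bdd (fun i B => ∀ y ∈ box N m, |f i y| ≤ B)
  · exact fun i a b hab h y hy => (h y hy).trans hab
  · intro i
    exact (box_compact N m).exists_bound_of_continuousOn ((hf i).continuousOn.mono (box_sub N m))

lemma lip_on_box {N : ℕ} (m : ℕ) (f : Fin N → (Fin N → ℝ) → ℝ)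
    (hf : ∀ i, ContDiffOn ℝ 1 (f i) (posO N)) :
    ∃ L, 0 ≤ L ∧ ∀ i, ∀ y ∈ box N m, ∀ z ∈ box N m, |f i y - f i z| ≤ L * ‖y - z‖ := by
  apply fin_bdd (fun i L => ∀ y ∈ box N m, ∀ z ∈ box N m, |f i y - f i z| ≤ L * ‖y - z‖)
  · exact fun i a b hab h y hy z hz => (h y hy z hz).trans
      (mul_le_mul_of_nonneg_right hab (norm_nonneg _))
  · intro i
    obtain ⟨K, hK⟩ := ((hf i).mono (box_sub N m)).exists_lipschitzOnWith one_ne_zero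
      (box_convex N m) (box_compact N m)
    refine ⟨K, fun y hy z hz => ?_⟩
    have := hK.dist_le_mul y hy z hz
    rwa [Real.dist_eq, dist_eq_norm] at this

section path
variable {N : ℕ} {P : Matrix (Fin N) (Fin N) ℝ} {μ : Fin N → ℝ} {α : ℝ}

lemma path_conv (hN : 2 ≤ N) (hP : ∀ i j, 0 ≤ P i j) (hrow : ∀ i, ∑ j, P i j = 1)
    (hprim : ∃ k : ℕ, ∀ i j, 0 < (P ^ k) i j)
    (hμ : ∀ i, 0 < μ i) (hrev : ∀ i j, μ i * P i j = μ j * P j i)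
    (m : ℕ) (x : ℕ → Fin N → ℝ) (X : ℕ → Fin N) (γ : ℕ → ℝ) (hγpos : ∀ n, 0 ≤ γ n)
    (hanti : Antitone γ) (hγ0 : Tendsto γ atTop (𝓝 0)) (hγ2 : Summable fun n => γ n ^ 2)
    (hx : ∀ n, x n ∈ box N m) (hstep : ∀ n, ‖x (n+1) - x n‖ ≤ γ n) (j : Fin N)
    (hmart : ∃ s, Tendsto (fun n => ∑ k ∈ range n, γ k *
      (srZ P μ α (x k) (X (k+1)) j - srH P μ α (x k) (X k) j)) atTop (𝓝 s)) :
    ∃ s, Tendsto (fun n => ∑ k ∈ range n, γ k *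
      ((if X (k+1) = j then 1 else 0) - srPi P μ α (x k) j)) atTop (𝓝 s) := by
  obtain ⟨B, hB0, hB⟩ := bound_on_box m (fun i y => srH P μ α y i j)
    (fun i => srH_contDiff hN hP hrow hprim hμ hrev i j)
  obtain ⟨L, hL0, hL⟩ := lip_on_box m (fun i y => srH P μ α y i j)
    (fun i => srH_contDiff hN hP hrow hprim hμ hrev i j)
  obtain ⟨s1, hs1⟩ := hmart
  obtain ⟨s2, hs2⟩ := abel_conv (fun n => srH P μ α (x n) (X n) j) γ B
    (fun n => hB _ _ (hx n)) hanti hγ0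
  have hs3 : Summable (fun k => γ k *
      (srH P μ α (x (k+1)) (X (k+1)) j - srH P μ α (x k) (X (k+1)) j)) := by
    refine Summable.of_norm_bounded (hγ2.mul_left L) fun n => ?_
    rw [norm_mul, Real.norm_of_nonneg (hγpos n), Real.norm_eq_abs]
    have h1 := hL (X (n+1)) _ (hx (n+1)) _ (hx n)
    have h2 : L * ‖x (n+1) - x n‖ ≤ L * γ n := mul_le_mul_of_nonneg_left (hstep n) hL0
    calc _ ≤ γ n * (L * γ n) := mul_le_mul_of_nonneg_left (h1.trans h2) (hγpos n)
      _ = _ := by ring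
  refine ⟨_, ((hs1.add hs2).add hs3.hasSum.tendsto_sum_nat).congr fun n => ?_⟩
  rw [← Finset.sum_add_distrib, ← Finset.sum_add_distrib]
  refine Finset.sum_congr rfl fun k _ => ?_
  rw [← srZ_poisson hN hP hrow hprim hμ hrev (box_sub N m (hx k)) (X (k+1)) j]
  simp only [srH]
  ring

lemma srK_meas (i j : Fin N) : Measurable (fun y => srrwKernel P μ α y i j) := by
  simp only [srrwKernel, Matrix.of_apply]
  fun_prop

lemma mart_part (hN : 2 ≤ N) (hP : ∀ i j, 0 ≤ P i j) (hrow : ∀ i, ∑ j, P i j = 1)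
    (hprim : ∃ k : ℕ, ∀ i j, 0 < (P ^ k) i j)
    (hμ : ∀ i, 0 < μ i) (hrev : ∀ i j, μ i * P i j = μ j * P j i)
    (γ : ℕ → ℝ) (hγpos : ∀ n, 0 ≤ γ n) (hγ2 : Summable fun n => γ n ^ 2)
    {Ω : Type*} [mΩ : MeasurableSpace Ω]
    (Pr : Measure Ω) [IsProbabilityMeasure Pr]
    (F : Filtration ℕ mΩ)
    (X : ℕ → Ω → Fin N) (x : ℕ → Ω → (Fin N → ℝ))
    (hX : ∀ n, Measurable[F n] (X n))
    (hx : ∀ n, Measurable[F n] (x n))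
    (hxp : ∀ n ω, x n ω ∈ posO N)
    (hcond : ∀ (n : ℕ) (j : Fin N),
      (Pr[(fun ω => if X (n + 1) ω = j then (1 : ℝ) else 0)|F n]) =ᵐ[Pr]
        fun ω => srrwKernel P μ α (x n ω) (X n ω) j) (m : ℕ) (j : Fin N) :
    ∀ᵐ ω ∂Pr, (∀ n, x n ω ∈ box N m) → ∃ s, Tendsto (fun n => ∑ k ∈ range n, γ k *
      (srZ P μ α (x k ω) (X (k+1) ω) j - srH P μ α (x k ω) (X k ω) j)) atTop (𝓝 s) := by
  classical
  set ζ : Fin N → (Fin N → ℝ) → ℝ := fun l => (box N m).indicator (fun y => srZ P μ α y l j) with hζ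
  have hZc := fun l => srZ_contDiff (α := α) hN hP hrow hprim hμ hrev l j
  have hζm : ∀ l, Measurable (ζ l) := by
    intro l
    have hc : ContinuousOn (fun y => srZ P μ α y l j) (box N m) :=
      (hZc l).continuousOn.mono (box_sub N m)
    simp only [hζ]
    rw [← Set.piecewise_eq_indicator]
    exact hc.measurable_piecewise continuousOn_const (box_compact N m).measurableSet
  obtain ⟨B, hB0, hB⟩ := bound_on_box m (fun l y => srZ P μ α y l j) hZc
  have hζb : ∀ l y, |ζ l y| ≤ B := by
    intro l y
    by_cases hy : y ∈ box N m
    · simp only [hζ, Set.indicator_of_mem hy]; exact hB l y hy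
    · simp only [hζ, Set.indicator_of_notMem hy, abs_zero]; exact hB0
  set d : ℕ → Ω → ℝ := fun n ω => ζ (X (n+1) ω) (x n ω) -
    ∑ l, srrwKernel P μ α (x n ω) (X n ω) l * ζ l (x n ω) with hd
  have hkm : ∀ n l, Measurable[F n] (fun ω => srrwKernel P μ α (x n ω) (X n ω) l) := by
    intro n l
    exact @meas_select N Ω (F n) (X n) (hX n) (fun i ω => srrwKernel P μ α (x n ω) i l)
      (fun i => (srK_meas i l).comp (hx n))
  have hkb : ∀ n l ω, |srrwKernel P μ α (x n ω) (X n ω) l| ≤ 1 := by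
    intro n l ω
    rw [abs_of_nonneg (srK_nonneg hP hrow hμ (hxp n ω) _ _)]
    exact srK_le hP hrow hμ (hxp n ω) _ _
  have hd0 : ∀ n, Pr[d n | F n] =ᵐ[Pr] 0 := by
    intro n
    exact condExp_diff (F n) Pr (F.le n) (X (n+1)) ((hX (n+1)).mono (F.le _) le_rfl)
      (fun l ω => srrwKernel P μ α (x n ω) (X n ω) l) (hcond n) (fun l ω => ζ l (x n ω))
      (fun l => Measurable.stronglyMeasurable ((hζm l).comp (hx n))) B (fun l ω => hζb l _)
      (fun l => Measurable.stronglyMeasurable (hkm n l)) (fun l ω => hkb n l ω)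
  have hdm : ∀ n, Measurable[F (n+1)] (d n) := by
    intro n
    have hle : F n ≤ F (n+1) := F.mono (Nat.le_succ n)
    refine Measurable.sub ?_ (Finset.measurable_fun_sum _ fun l _ => Measurable.mul ?_ ?_)
    · exact @meas_select N Ω (F (n+1)) (X (n+1)) (hX (n+1)) (fun i ω => ζ i (x n ω))
        (fun i => (hζm i).comp ((hx n).mono hle le_rfl))
    · exact (hkm n l).mono hle le_rfl
    · exact (hζm l).comp ((hx n).mono hle le_rfl)
  have hdb : ∀ n ω, |d n ω| ≤ B + ∑ _l : Fin N, B := by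
    intro n ω
    refine (abs_sub _ _).trans (add_le_add (hζb _ _) ?_)
    refine (Finset.abs_sum_le_sum_abs _ _).trans (Finset.sum_le_sum fun l _ => ?_)
    rw [abs_mul]
    have := mul_le_mul (hkb n l ω) (hζb l (x n ω)) (abs_nonneg _) zero_le_one
    linarith
  have := mart_conv Pr F (fun n => γ n • d n) (fun n => γ n * (B + ∑ _l : Fin N, B))
    (fun n => (Measurable.stronglyMeasurable (hdm n)).const_smul (γ n))
    (fun n ω => by
      rw [Pi.smul_apply, smul_eq_mul, abs_mul, abs_of_nonneg (hγpos n)]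
      exact mul_le_mul_of_nonneg_left (hdb n ω) (hγpos n))
    (by simp_rw [mul_pow]; exact hγ2.mul_right _)
    (fun n => by
      filter_upwards [condExp_smul (γ n) (d n) (F n) (μ := Pr), hd0 n] with ω h1 h2
      rw [h1, Pi.smul_apply, h2]; simp)
  filter_upwards [this] with ω hω hbox
  obtain ⟨s, hs⟩ := hω
  refine ⟨s, hs.congr fun n => Finset.sum_congr rfl fun k _ => ?_⟩
  simp only [Pi.smul_apply, smul_eq_mul, hd, hζ, Set.indicator_of_mem (hbox k), srH]

end path
/-- **Almost sure convergence of the generalized weighted empirical measure of the SRRW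
to the target distribution:** for every initial pair `(x₀, X₀)` (the processes below have
arbitrary initial data), with probability one, `lim_{n→∞} x_n = μ`. -/
theorem srrw_empirical_measure_converges_as
    {N : ℕ} (hN : 2 ≤ N)
    (P : Matrix (Fin N) (Fin N) ℝ) (μv : Fin N → ℝ)
    (hP_nonneg : ∀ i j, 0 ≤ P i j)
    (hP_rowsum : ∀ i, ∑ j, P i j = 1)
    (hP_irred_aperiodic : ∃ k : ℕ, ∀ i j, 0 < (P ^ k) i j)
    (hμ_pos : ∀ i, 0 < μv i) (hμ_sum : ∑ i, μv i = 1)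
    (hrev : ∀ i j, μv i * P i j = μv j * P j i)
    (α : ℝ) (hα : 0 ≤ α)
    (a : ℝ) (ha : 1 / 2 < a) (ha1 : a ≤ 1)
    (γ : ℕ → ℝ) (hγ : ∀ n, γ n = ((n : ℝ) + 1) ^ (-a))
    {Ω : Type*} [mΩ : MeasurableSpace Ω]
    (Pr : Measure Ω) [IsProbabilityMeasure Pr]
    (F : Filtration ℕ mΩ)
    (X : ℕ → Ω → Fin N) (x : ℕ → Ω → (Fin N → ℝ))
    (hX_adapted : ∀ n, Measurable[F n] (X n))
    (hx_adapted : ∀ n, Measurable[F n] (x n))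
    (hx_simplex : ∀ n ω, x n ω ∈ intSimplex N)
    (hcond : ∀ (n : ℕ) (j : Fin N),
      (Pr[(fun ω => if X (n + 1) ω = j then (1 : ℝ) else 0)|F n]) =ᵐ[Pr]
        fun ω => srrwKernel P μv α (x n ω) (X n ω) j)
    (hrec : ∀ (n : ℕ) (ω : Ω),
      x (n + 1) ω = x n ω + γ (n + 1) • (Pi.single (X (n + 1) ω) (1 : ℝ) - x n ω))
    (hstable : ∀ᵐ ω ∂Pr, ∃ C : Set (Fin N → ℝ),
      IsCompact C ∧ C ⊆ intSimplex N ∧ ∀ n, x n ω ∈ C) :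
    ∀ᵐ ω ∂Pr, Tendsto (fun n => x n ω) atTop (𝓝 μv) := by
  set g : ℕ → ℝ := fun n => γ (n + 1) with hg
  have hgval : ∀ n, g n = ((n : ℝ) + 2) ^ (-a) := by
    intro n
    simp only [hg, hγ]
    push_cast
    congr 1
    ring
  have hgpos : ∀ n, 0 ≤ g n := fun n => by rw [hgval]; positivity
  have hg1 : ∀ n, g n ≤ 1 := fun n => by
    rw [hgval]
    exact Real.rpow_le_one_of_one_le_of_nonpos (by linarith [Nat.cast_nonneg (α := ℝ) n])
      (by linarith)
  have hganti : Antitone g := by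
    intro n k hnk
    rw [hgval, hgval]
    apply Real.rpow_le_rpow_of_nonpos (by positivity) _ (by linarith)
    have : (n : ℝ) ≤ k := by exact_mod_cast hnk
    linarith
  have hgs : ∀ n : ℕ, g n = ((n + 2 : ℕ) : ℝ) ^ (-a) := fun n => by rw [hgval]; push_cast; rfl
  have hg0 : Tendsto g atTop (𝓝 0) := by
    have h1 := (tendsto_rpow_neg_atTop (y := a) (by linarith)).comp
      (tendsto_natCast_atTop_atTop.comp (tendsto_add_atTop_nat 2))
    exact h1.congr fun n => by simp only [Function.comp, hgs]
  have hg2 : Summable fun n => g n ^ 2 := by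
    have h1 : Summable (fun n : ℕ => (n : ℝ) ^ (-(2 * a))) :=
      Real.summable_nat_rpow.2 (by linarith)
    have h2 := (summable_nat_add_iff 2).2 h1
    refine h2.congr fun n => ?_
    rw [hgs, ← Real.rpow_natCast, ← Real.rpow_mul (by positivity)]
    congr 1
    push_cast
    ring
  have hgsum : Tendsto (fun n => ∑ k ∈ range n, g k) atTop atTop := by
    rw [← not_summable_iff_tendsto_nat_atTop_of_nonneg hgpos]
    intro hs
    have h1 : Summable (fun n : ℕ => (n : ℝ) ^ (-a)) := by
      rw [← summable_nat_add_iff 2]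
      exact hs.congr fun n => hgs n
    have := Real.summable_nat_rpow.1 h1
    linarith
  have hxp : ∀ n ω, x n ω ∈ posO N := fun n ω => (hx_simplex n ω).1
  have hxle : ∀ n ω i, x n ω i ≤ 1 := by
    intro n ω i
    rw [← (hx_simplex n ω).2]
    exact Finset.single_le_sum (f := fun i => x n ω i) (fun k _ => (hxp n ω k).le) (mem_univ i)
  have hmart := fun m j => mart_part hN hP_nonneg hP_rowsum hP_irred_aperiodic hμ_pos hrev
    g hgpos hg2 Pr F X x hX_adapted hx_adapted hxp hcond m j
  have hmart' := ae_all_iff.2 fun m => ae_all_iff.2 fun j => hmart m j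
  obtain ⟨V, hVc, hVμ, hVpos, hVneg⟩ := exists_lyap hN hP_nonneg hP_rowsum hμ_pos hμ_sum hrev hα
  filter_upwards [hstable, hmart'] with ω hst hmt
  obtain ⟨C, hCc, hCs, hxC⟩ := hst
  have hbox : ∃ m : ℕ, ∀ n, x n ω ∈ box N m := by
    have h1 : ∀ i, ∃ c > 0, ∀ y ∈ C, c ≤ y i := by
      intro i
      obtain ⟨y0, hy0, hmin⟩ := hCc.exists_isMinOn ⟨_, hxC 0⟩
        (continuous_apply i : Continuous fun y : Fin N → ℝ => y i).continuousOn
      exact ⟨y0 i, (hCs hy0).1 i, fun y hy => hmin hy⟩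
    choose c hc0 hc using h1
    have h2 : ∀ᶠ m : ℕ in atTop, ∀ i, 1 / ((m : ℝ) + 1) < c i :=
      eventually_all.2 fun i =>
        tendsto_one_div_add_atTop_nhds_zero_nat.eventually_lt_const (hc0 i)
    obtain ⟨m, hm⟩ := h2.exists
    exact ⟨m, fun n => ⟨fun i => (hm i).le.trans (hc i _ (hxC n)), fun i => hxle n ω i⟩⟩
  obtain ⟨m, hm⟩ := hbox
  have hstep : ∀ n, ‖x (n+1) ω - x n ω‖ ≤ g n := by
    intro n
    rw [hrec, add_sub_cancel_left, norm_smul]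
    have h1 : ‖(Pi.single (X (n + 1) ω) (1 : ℝ) - x n ω : Fin N → ℝ)‖ ≤ 1 := by
      rw [pi_norm_le_iff_of_nonneg zero_le_one]
      intro i
      rw [Pi.sub_apply, Real.norm_eq_abs, abs_le]
      have h2 := hxp n ω i
      have h3 := hxle n ω i
      by_cases h : i = X (n+1) ω
      · subst h; simp only [Pi.single_eq_same]; constructor <;> linarith
      · rw [Pi.single_eq_of_ne h]; constructor <;> linarith
    rw [Real.norm_of_nonneg (hgpos n)]
    exact mul_le_of_le_one_right (hgpos n) h1
  have hs := fun j => path_conv (α := α) hN hP_nonneg hP_rowsum hP_irred_aperiodic hμ_pos hrev m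
    (fun n => x n ω) (fun n => X n ω) g hgpos hganti hg0 hg2 hm hstep j (hmt m j hm)
  choose sI hsI using hs
  refine det_conv (box N m ∩ {y | ∑ i, y i = 1}) (posO N) ?_ (isOpen_posO N)
    (Set.inter_subset_left.trans (box_sub N m)) V (fderiv ℝ V) ?_ ?_ μv hVμ ?_
    (fun y i => srPi P μv α y i - y i) ?_ ?_ (fun n => x n ω)
    (fun n j => ∑ k ∈ range n, g k *
      ((if X (k+1) ω = j then 1 else 0) - srPi P μv α (x k ω) j)) sI g ?_ ?_ ?_ hgpos hg0 hgsum
  · exact (box_compact N m).inter_right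
      (isClosed_eq (continuous_finsetSum _ fun i _ => continuous_apply i) continuous_const)
  · intro y hy
    exact ((hVc.contDiffAt ((isOpen_posO N).mem_nhds hy)).differentiableAt one_ne_zero).hasFDerivAt
  · exact hVc.continuousOn_fderiv_of_isOpen (isOpen_posO N) le_rfl
  · exact fun y hy hne => hVpos y ⟨box_sub N m hy.1, hy.2⟩ hne
  · apply continuousOn_pi.2
    intro i
    exact ((srPi_contDiff hN hP_nonneg hP_rowsum hμ_pos i).continuousOn.mono
      (Set.inter_subset_left.trans (box_sub N m))).sub (continuous_apply i).continuousOn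
  · exact fun y hy hne => hVneg y ⟨box_sub N m hy.1, hy.2⟩ hne
  · exact fun n => ⟨hm n, (hx_simplex n ω).2⟩
  · intro n
    funext j
    rw [hrec n ω]
    simp only [Pi.add_apply, Pi.smul_apply, Pi.sub_apply, smul_eq_mul, Finset.sum_range_succ,
      Pi.single_apply, eq_comm (a := j)]
    simp only [hg]
    ring
  · exact tendsto_pi_nhds.2 hsI
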